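/- arXiv:1905.10473 — 2 statements merged into one kernel-verified Lean document; each statement's English description precedes it below -/
import Mathlib

section
/- Let (A,X) be a C*-correspondence, H a Hilbert space, π: O_X → B(H) a *-homomorphism, and φ: O_X → B(H) a completely positive, completely contractive map such that φ = π on S(A,X). Then for every a ∈ J_X and every x ∈ X one has φ(ι¹(a·x)·ι¹(a·x)*) = φ(ι¹(a·x))·φ(ι¹(a·x))*; consequently ι¹(a·x) lies in the multiplicative domain of φ, i.e. φ(ι¹(a·x)·w) = φ(ι¹(a·x))·φ(w) and φ(w·ι¹(a·x)) = φ(w)·φ(ι¹(a·x)) for all w ∈ O_X. -/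
/-!
Common framework: Hilbert C*-modules, C*-correspondences, compact operators,
the Katsura ideal, Toeplitz pairs, covariance, Cuntz-Pimsner algebras,
completely positive completely contractive maps, and hyperrigidity.
-/

noncomputable section

open Filter Topology Set
open scoped ComplexOrder InnerProductSpace

universe u v w u'

/-- A right Hilbert C*-module `X` over a (possibly non-unital) C*-algebra `A`.
`smulR x a` is the right action `x·a`, and `inner x y` is the `A`-valued inner
product `⟨x,y⟩`, conjugate-linear in the first variable.  The Cauchy-Schwarz
inequality `norm_inner_le` and `norm_smulR_le` are consequences of the other
axioms which we record as fields for convenience. -/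
structure HilbertModule (A : Type u) (X : Type v) [NonUnitalCStarAlgebra A]
    [NormedAddCommGroup X] [NormedSpace ℂ X] [CompleteSpace X] : Type (max u v) where
  smulR : X → A → X
  inner : X → X → A
  smulR_add_left : ∀ x y a, smulR (x + y) a = smulR x a + smulR y a
  smulR_add_right : ∀ x a b, smulR x (a + b) = smulR x a + smulR x b
  smulR_csmul_left : ∀ (z : ℂ) x a, smulR (z • x) a = z • smulR x a
  smulR_csmul_right : ∀ (z : ℂ) x a, smulR x (z • a) = z • smulR x a
  smulR_mul : ∀ x a b, smulR (smulR x a) b = smulR x (a * b)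
  inner_add_right : ∀ x y z, inner x (y + z) = inner x y + inner x z
  inner_csmul_right : ∀ (z : ℂ) x y, inner x (z • y) = z • inner x y
  star_inner : ∀ x y, star (inner x y) = inner y x
  inner_smulR_right : ∀ x y a, inner x (smulR y a) = inner x y * a
  inner_self_nonneg : ∀ x, ∃ a, inner x x = star a * a
  inner_self_eq_zero : ∀ x, inner x x = 0 → x = 0
  norm_sq_eq_norm_inner_self : ∀ x, ‖x‖ ^ 2 = ‖inner x x‖
  norm_inner_le : ∀ x y, ‖inner x y‖ ≤ ‖x‖ * ‖y‖
  norm_smulR_le : ∀ x a, ‖smulR x a‖ ≤ ‖x‖ * ‖a‖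

/-- A C*-correspondence over `A`:  a right Hilbert `A`-module together with a
left action of `A` by adjointable operators, i.e. a *-homomorphism
`λ = lact : A → L(X)`. -/
structure Correspondence (A : Type u) (X : Type v) [NonUnitalCStarAlgebra A]
    [NormedAddCommGroup X] [NormedSpace ℂ X] [CompleteSpace X]
    extends HilbertModule A X where
  lact : A → X →L[ℂ] X
  lact_add : ∀ a b, lact (a + b) = lact a + lact b
  lact_csmul : ∀ (z : ℂ) a, lact (z • a) = z • lact a
  lact_mul : ∀ a b, lact (a * b) = (lact a).comp (lact b)
  lact_adjoint : ∀ a x y, inner (lact a x) y = inner x (lact (star a) y)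
  lact_smulR : ∀ a x b, lact a (smulR x b) = smulR (lact a x) b

namespace HilbertModule

variable {A : Type u} {X : Type v} [NonUnitalCStarAlgebra A]
  [NormedAddCommGroup X] [NormedSpace ℂ X] [CompleteSpace X]

/-- The rank-one operator `θ_{x,y} : z ↦ x·⟨y,z⟩` on a Hilbert module. -/
def rankOne (M : HilbertModule A X) (x y : X) : X →L[ℂ] X :=
  LinearMap.mkContinuous
    { toFun := fun z => M.smulR x (M.inner y z)
      map_add' := fun z w => by
        show M.smulR x (M.inner y (z + w)) = M.smulR x (M.inner y z) + M.smulR x (M.inner y w)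
        rw [M.inner_add_right, M.smulR_add_right]
      map_smul' := fun c z => by
        show M.smulR x (M.inner y (c • z)) = c • M.smulR x (M.inner y z)
        rw [M.inner_csmul_right, M.smulR_csmul_right] }
    (‖x‖ * ‖y‖)
    (fun z => by
      calc ‖M.smulR x (M.inner y z)‖ ≤ ‖x‖ * ‖M.inner y z‖ := M.norm_smulR_le _ _
        _ ≤ ‖x‖ * (‖y‖ * ‖z‖) :=
            mul_le_mul_of_nonneg_left (M.norm_inner_le y z) (norm_nonneg x)
        _ = ‖x‖ * ‖y‖ * ‖z‖ := (mul_assoc _ _ _).symm)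

/-- `K(X)`, the compact operators on the Hilbert module `X`: the closed linear
span of the rank-one operators, viewed as a (closed) subspace of the bounded
operators on `X`. -/
def compacts (M : HilbertModule A X) : Submodule ℂ (X →L[ℂ] X) :=
  (Submodule.span ℂ (Set.range fun p : X × X => M.rankOne p.1 p.2)).topologicalClosure

theorem rankOne_mem_compacts (M : HilbertModule A X) (x y : X) :
    M.rankOne x y ∈ M.compacts :=
  Submodule.le_topologicalClosure _ (Submodule.subset_span ⟨(x, y), rfl⟩)

end HilbertModule

namespace Correspondence

variable {A : Type u} {X : Type v} [NonUnitalCStarAlgebra A]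
  [NormedAddCommGroup X] [NormedSpace ℂ X] [CompleteSpace X]

/-- The Katsura ideal `J_X` of a C*-correspondence: the set of `a ∈ A` such
that `λ(a)` is a compact operator on `X` and `a·b = 0` for every `b` in the
kernel of the left action `λ`. -/
def katsura (c : Correspondence A X) : Set A :=
  {a | c.lact a ∈ c.toHilbertModule.compacts ∧ ∀ b, c.lact b = 0 → a * b = 0}

/-- The left action of the Katsura ideal on `X` is non-degenerate: the closed
linear span of `{a·x : a ∈ J_X, x ∈ X}` is all of `X`. -/
def KatsuraNondegenerate (c : Correspondence A X) : Prop :=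
  (Submodule.span ℂ {z : X | ∃ a ∈ c.katsura, ∃ x : X, z = c.lact a x}).topologicalClosure = ⊤

end Correspondence

/-- A Toeplitz pair `(π⁰, π¹)` from the C*-correspondence `(A, X)` to a
C*-algebra `C`: a *-homomorphism `π⁰ : A → C` and a linear map `π¹ : X → C`
with `π⁰(a)π¹(x) = π¹(a·x)` and `π¹(x)*π¹(y) = π⁰(⟨x,y⟩)`. -/
structure ToeplitzPair {A : Type u} {X : Type v} [NonUnitalCStarAlgebra A]
    [NormedAddCommGroup X] [NormedSpace ℂ X] [CompleteSpace X]
    (c : Correspondence A X) (C : Type w) [NonUnitalCStarAlgebra C] : Type (max u v w) where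
  p0 : A →⋆ₙₐ[ℂ] C
  p1 : X →ₗ[ℂ] C
  p0_mul_p1 : ∀ a x, p0 a * p1 x = p1 (c.lact a x)
  star_p1_mul_p1 : ∀ x y, star (p1 x) * p1 y = p0 (c.toHilbertModule.inner x y)

namespace ToeplitzPair

variable {A : Type u} {X : Type v} [NonUnitalCStarAlgebra A]
  [NormedAddCommGroup X] [NormedSpace ℂ X] [CompleteSpace X]
  {c : Correspondence A X} {C : Type w} [NonUnitalCStarAlgebra C]

/-- A Toeplitz pair is covariant if `π⁰(a) = φ_π(λ(a))` for all `a ∈ J_X`,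
where `φ_π : K(X) → C` is the (unique, automatically *-homomorphic) continuous
linear map with `φ_π(θ_{x,y}) = π¹(x)π¹(y)*`. -/
def IsCovariant (T : ToeplitzPair c C) : Prop :=
  ∃ Φ : (c.toHilbertModule.compacts : Submodule ℂ (X →L[ℂ] X)) →L[ℂ] C,
    (∀ x y : X, Φ ⟨c.toHilbertModule.rankOne x y,
        c.toHilbertModule.rankOne_mem_compacts x y⟩ = T.p1 x * star (T.p1 y)) ∧
    ∀ a, (ha : a ∈ c.katsura) → T.p0 a = Φ ⟨c.lact a, ha.1⟩

end ToeplitzPair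

/-- `O` together with the covariant Toeplitz pair `ι = (ι⁰, ι¹)` is (a copy of)
the Cuntz-Pimsner algebra of the C*-correspondence `(A, X)`: `ι⁰` is injective,
`O` is generated as a C*-algebra by `ι⁰(A) ∪ ι¹(X)`, and every covariant
Toeplitz pair factors through `O`. -/
structure IsCuntzPimsner {A : Type u} {X : Type v} [NonUnitalCStarAlgebra A]
    [NormedAddCommGroup X] [NormedSpace ℂ X] [CompleteSpace X]
    (c : Correspondence A X) (O : Type w) [NonUnitalCStarAlgebra O]
    (ι : ToeplitzPair c O) : Prop where
  covariant : ι.IsCovariant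
  injective : Function.Injective ι.p0
  generates :
    closure ((NonUnitalStarAlgebra.adjoin ℂ (Set.range ι.p0 ∪ Set.range ι.p1) :
      NonUnitalStarSubalgebra ℂ O) : Set O) = Set.univ
  universal : ∀ (C : Type u') [NonUnitalCStarAlgebra C] (T : ToeplitzPair c C),
    T.IsCovariant → ∃ ρ : O →⋆ₙₐ[ℂ] C, (∀ a, ρ (ι.p0 a) = T.p0 a) ∧ ∀ x, ρ (ι.p1 x) = T.p1 x

/-- The operator space `S(A,X)`: the closed linear span of
`ι⁰(A) ∪ ι¹(X) ∪ ι¹(X)*` inside the Cuntz-Pimsner algebra. -/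
def SAX {A : Type u} {X : Type v} [NonUnitalCStarAlgebra A]
    [NormedAddCommGroup X] [NormedSpace ℂ X] [CompleteSpace X]
    {c : Correspondence A X} {O : Type w} [NonUnitalCStarAlgebra O]
    (ι : ToeplitzPair c O) : Set O :=
  closure ((Submodule.span ℂ (Set.range ι.p0 ∪ Set.range ι.p1 ∪ star '' Set.range ι.p1) :
    Submodule ℂ O) : Set O)

/-- `φ : C → B(H)` is a completely positive and completely contractive linear
map.  Complete positivity is recorded through the standard characterization:
for all `n`, `a : Fin n → C` and `h : Fin n → H` one has
`0 ≤ ∑_{i,j} ⟪h i, φ(a i * a j)(h j)⟫` (every positive matrix over `C` is a sum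
of Gram matrices `(a_i* a_j)_{ij}`, and positivity of a matrix of operators is
tested against vectors, so this is exactly positivity of all amplifications).
For completely positive maps the completely bounded norm coincides with the
norm, so complete contractivity is recorded as contractivity. -/
structure IsCPCMap {C : Type w} [NonUnitalCStarAlgebra C] {H : Type u'}
    [NormedAddCommGroup H] [InnerProductSpace ℂ H] [CompleteSpace H]
    (φ : C → H →L[ℂ] H) : Prop where
  map_add : ∀ x y, φ (x + y) = φ x + φ y
  map_smul : ∀ (z : ℂ) x, φ (z • x) = z • φ x
  completely_positive : ∀ (n : ℕ) (a : Fin n → C) (h : Fin n → H),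
    0 ≤ ∑ i, ∑ j, ⟪h i, φ (star (a i) * a j) (h j)⟫_ℂ
  contractive : ∀ x, ‖φ x‖ ≤ ‖x‖

/-- Hyperrigidity of a C*-correspondence `(A,X)` (with Cuntz-Pimsner algebra
`O` and canonical covariant pair `ι`): for every Hilbert space `H`, every
*-homomorphism `π : O → B(H)` and every completely positive completely
contractive map `φ : O → B(H)` agreeing with `π` on `S(A,X)`, one has `φ = π`. -/
def Hyperrigid {A : Type u} {X : Type v} [NonUnitalCStarAlgebra A]
    [NormedAddCommGroup X] [NormedSpace ℂ X] [CompleteSpace X]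
    (c : Correspondence A X) (O : Type w) [NonUnitalCStarAlgebra O]
    (ι : ToeplitzPair c O) : Prop :=
  ∀ (H : Type u') [NormedAddCommGroup H] [InnerProductSpace ℂ H] [CompleteSpace H]
    (π : O →⋆ₙₐ[ℂ] (H →L[ℂ] H)) (φ : O → H →L[ℂ] H),
    IsCPCMap φ → (∀ s ∈ SAX ι, φ s = π s) → ∀ w : O, φ w = π w

namespace IsCPCMap

variable {C : Type w} [NonUnitalCStarAlgebra C] {H : Type u'}
  [NormedAddCommGroup H] [InnerProductSpace ℂ H] [CompleteSpace H] {φ : C → H →L[ℂ] H}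

theorem map_neg (hφ : IsCPCMap φ) (x : C) : φ (-x) = -φ x := by
  simpa using hφ.map_smul (-1) x

theorem map_sub (hφ : IsCPCMap φ) (x y : C) : φ (x - y) = φ x - φ y := by
  rw [sub_eq_add_neg, hφ.map_add, hφ.map_neg, sub_eq_add_neg]

theorem continuous (hφ : IsCPCMap φ) : Continuous φ := by
  refine (LipschitzWith.of_dist_le_mul (K := 1) fun x y => ?_).continuous
  rw [dist_eq_norm, dist_eq_norm, ← hφ.map_sub]
  simpa using hφ.contractive (x - y)

theorem star_map_star_mul (hφ : IsCPCMap φ) (x y : C) :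
    star (φ (star x * y)) = φ (star y * x) := by
  have real_sum : ∀ h g : H,
      (⟪h, φ (star x * y) g⟫_ℂ + ⟪g, φ (star y * x) h⟫_ℂ).im = 0 := by
    intro h g
    have h₁ := hφ.completely_positive 2 ![x, y] ![h, g]
    have h₂ := hφ.completely_positive 1 ![x] ![h]
    have h₃ := hφ.completely_positive 1 ![y] ![g]
    simp only [Fin.sum_univ_two, Fin.sum_univ_one, Complex.le_def] at h₁ h₂ h₃
    simp at h₁ h₂ h₃
    simp only [Complex.add_im]
    linarith [h₁.2, h₂.2, h₃.2]
  refine ContinuousLinearMap.ext fun h => ext_inner_left ℂ fun g => ?_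
  rw [ContinuousLinearMap.star_eq_adjoint, ContinuousLinearMap.adjoint_inner_right,
    ← inner_conj_symm]
  have h₁ := real_sum h g
  have h₂ := real_sum h (Complex.I • g)
  simp only [_root_.map_smul, inner_smul_left, inner_smul_right, Complex.add_im, Complex.mul_im,
    Complex.conj_I, Complex.neg_re, Complex.neg_im, Complex.I_re, Complex.I_im] at h₁ h₂
  apply Complex.ext
  · rw [Complex.conj_re]; linarith
  · rw [Complex.conj_im]; linarith

end IsCPCMap

theorem NonUnitalCStarAlgebra.exists_approximateUnit (C : Type w) [NonUnitalCStarAlgebra C] :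
    ∃ l : Filter C, l.IsApproximateUnit ∧ (∀ᶠ e in l, star e = e) ∧ ∀ᶠ e in l, ‖e‖ ≤ 1 := by
  let _ := CStarAlgebra.spectralOrder C
  let _ := CStarAlgebra.spectralOrderedRing C
  have hl := CStarAlgebra.increasingApproximateUnit (A := C)
  exact ⟨_, hl.toIsApproximateUnit, hl.eventually_star_eq, hl.eventually_norm⟩

namespace IsCPCMap

variable {C : Type w} [NonUnitalCStarAlgebra C] {H : Type u'}
  [NormedAddCommGroup H] [InnerProductSpace ℂ H] [CompleteSpace H] {φ : C → H →L[ℂ] H}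

theorem map_star (hφ : IsCPCMap φ) (x : C) : φ (star x) = star (φ x) := by
  obtain ⟨l, hl, hstar, -⟩ := NonUnitalCStarAlgebra.exists_approximateUnit C
  have := hl.neBot
  have h₁ : Tendsto (fun e => φ (star x * e)) l (𝓝 (φ (star x))) :=
    (hφ.continuous.tendsto _).comp (hl.tendsto_mul_left (star x))
  have h₂ : Tendsto (fun e => star (φ (e * x))) l (𝓝 (star (φ x))) :=
    ((continuous_star.comp hφ.continuous).tendsto _).comp (hl.tendsto_mul_right x)
  refine tendsto_nhds_unique h₁ (h₂.congr' ?_)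
  filter_upwards [hstar] with e he
  rw [← hφ.star_map_star_mul e x, he]

/-- The Gram positivity of `φ` at `s ⊗ h`, `w ⊗ g` and the (ideal) vector `1 ⊗ k`. -/
theorem re_inner_nonneg (hφ : IsCPCMap φ) (s w : C) (h g k : H) :
    0 ≤ (⟪h, φ (star s * s) h⟫_ℂ).re + (⟪g, φ (star w * w) g⟫_ℂ).re + ‖k‖ ^ 2
      + 2 * (⟪h, φ (star s * w) g⟫_ℂ).re + 2 * (⟪h, φ (star s) k⟫_ℂ).re
      + 2 * (⟪k, φ w g⟫_ℂ).re := by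
  obtain ⟨l, hl, hstar, hnorm⟩ := NonUnitalCStarAlgebra.exists_approximateUnit C
  have := hl.neBot
  have re_symm : ∀ (x y : C) (a b : H),
      (⟪b, φ (star y * x) a⟫_ℂ).re = (⟪a, φ (star x * y) b⟫_ℂ).re := by
    intro x y a b
    rw [← hφ.star_map_star_mul, ContinuousLinearMap.star_eq_adjoint,
      ContinuousLinearMap.adjoint_inner_right, ← inner_conj_symm, Complex.conj_re]
  have lim₁ : Tendsto (fun e => (⟪h, φ (star s * e) k⟫_ℂ).re) l
      (𝓝 (⟪h, φ (star s) k⟫_ℂ).re) := by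
    have hc : Continuous fun y : C => (⟪h, φ y k⟫_ℂ).re := by
      have := hφ.continuous
      fun_prop
    exact (hc.tendsto _).comp (hl.tendsto_mul_left (star s))
  have lim₂ : Tendsto (fun e => (⟪k, φ (e * w) g⟫_ℂ).re) l (𝓝 (⟪k, φ w g⟫_ℂ).re) := by
    have hc : Continuous fun y : C => (⟪k, φ y g⟫_ℂ).re := by
      have := hφ.continuous
      fun_prop
    exact (hc.tendsto _).comp (hl.tendsto_mul_right w)
  refine ge_of_tendsto ((tendsto_const_nhds.add (lim₁.const_mul 2)).add (lim₂.const_mul 2)) ?_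
  filter_upwards [hstar, hnorm] with e he hne
  have hee : (⟪k, φ (star e * e) k⟫_ℂ).re ≤ ‖k‖ ^ 2 := by
    have h₁ : ‖star e * e‖ ≤ 1 := by
      rw [CStarRing.norm_star_mul_self]
      exact mul_le_one₀ hne (norm_nonneg _) hne
    calc (⟪k, φ (star e * e) k⟫_ℂ).re ≤ ‖k‖ * ‖φ (star e * e) k‖ :=
          re_inner_le_norm (𝕜 := ℂ) _ _
      _ ≤ ‖k‖ * (1 * ‖k‖) := by
          gcongr
          exact ContinuousLinearMap.le_of_opNorm_le _ ((hφ.contractive _).trans h₁) k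
      _ = ‖k‖ ^ 2 := by ring
  have hpos := (Complex.le_def.1 (hφ.completely_positive 3 ![s, e, w] ![h, k, g])).1
  simp only [Fin.sum_univ_three, Matrix.cons_val_zero, Matrix.cons_val_one, Matrix.cons_val,
    Complex.add_re, Complex.zero_re] at hpos
  rw [re_symm s e h k, re_symm s w h g, re_symm e w k g] at hpos
  rw [he] at hpos hee
  linarith

/-- If `φ (s* s) = φ(s)* φ(s)`, then `s*` is in the left multiplicative domain of `φ`. -/
theorem map_star_mul (hφ : IsCPCMap φ) {s : C}
    (hs : φ (star s * s) = star (φ s) * φ s) (w : C) :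
    φ (star s * w) = star (φ s) * φ w := by
  refine ContinuousLinearMap.ext fun g => sub_eq_zero.1 ?_
  set z : H := φ (star s * w) g - (star (φ s) * φ w) g with hz
  have key : ∀ t : ℝ,
      0 ≤ (⟪g, φ (star w * w) g⟫_ℂ).re * (t * t) + 2 * ‖z‖ ^ 2 * t + 0 := by
    intro t
    have h₁ := hφ.re_inner_nonneg s w z ((t : ℂ) • g) (-(φ s z))
    have e₁ : (⟪z, φ (star s * s) z⟫_ℂ).re = ‖φ s z‖ ^ 2 := by
      rw [hs, ContinuousLinearMap.star_eq_adjoint, mul_apply_eq_comp,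
        ContinuousLinearMap.adjoint_inner_right]
      exact inner_self_eq_norm_sq (𝕜 := ℂ) _
    have e₂ : (⟪z, φ (star s) (-(φ s z))⟫_ℂ).re = -‖φ s z‖ ^ 2 := by
      rw [hφ.map_star, ContinuousLinearMap.star_eq_adjoint,
        ContinuousLinearMap.adjoint_inner_right, inner_neg_right, Complex.neg_re]
      exact congrArg _ (inner_self_eq_norm_sq (𝕜 := ℂ) _)
    have e₃ : (⟪z, φ (star s * w) ((t : ℂ) • g)⟫_ℂ).re
        + (⟪-(φ s z), φ w ((t : ℂ) • g)⟫_ℂ).re = t * ‖z‖ ^ 2 := by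
      rw [inner_neg_left, ← ContinuousLinearMap.adjoint_inner_right,
        ← ContinuousLinearMap.star_eq_adjoint, ← Complex.add_re, ← sub_eq_add_neg,
        ← inner_sub_right, _root_.map_smul, _root_.map_smul, _root_.map_smul, ← smul_sub,
        inner_smul_right, Complex.re_ofReal_mul]
      exact congrArg _ (inner_self_eq_norm_sq (𝕜 := ℂ) z)
    have e₄ : (⟪(t : ℂ) • g, φ (star w * w) ((t : ℂ) • g)⟫_ℂ).re
        = (⟪g, φ (star w * w) g⟫_ℂ).re * (t * t) := by
      rw [_root_.map_smul, inner_smul_left, inner_smul_right, Complex.conj_ofReal,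
        Complex.re_ofReal_mul, Complex.re_ofReal_mul]
      ring
    rw [norm_neg] at h₁
    linarith
  have hd := discrim_le_zero key
  simp only [discrim, mul_zero, sub_zero] at hd
  have : ‖z‖ = 0 := by
    have h₀ : 2 * ‖z‖ ^ 2 = 0 := pow_eq_zero_iff two_ne_zero |>.1 (le_antisymm hd (sq_nonneg _))
    simpa using h₀
  exact norm_eq_zero.1 this

end IsCPCMap

namespace ToeplitzPair

variable {A : Type u} {X : Type v} [NonUnitalCStarAlgebra A]
  [NormedAddCommGroup X] [NormedSpace ℂ X] [CompleteSpace X]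
  {c : Correspondence A X} {C : Type w} [NonUnitalCStarAlgebra C]

theorem p0_mem_SAX (T : ToeplitzPair c C) (a : A) : T.p0 a ∈ SAX T :=
  subset_closure (Submodule.subset_span (Or.inl (Or.inl ⟨a, rfl⟩)))

theorem p1_mem_SAX (T : ToeplitzPair c C) (x : X) : T.p1 x ∈ SAX T :=
  subset_closure (Submodule.subset_span (Or.inl (Or.inr ⟨x, rfl⟩)))

/-- For a covariant pair, `π⁰(J_X)` lies in the closed linear span of `π¹(X)π¹(X)*`. -/
theorem IsCovariant.p0_mem_closure {T : ToeplitzPair c C} (hT : T.IsCovariant) {a : A}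
    (ha : a ∈ c.katsura) :
    T.p0 a ∈ (Submodule.span ℂ
      (Set.range fun p : X × X => T.p1 p.1 * star (T.p1 p.2))).topologicalClosure := by
  obtain ⟨Φ, hΦ, hcov⟩ := hT
  rw [hcov a ha]
  set R := Submodule.span ℂ (Set.range fun p : X × X => c.toHilbertModule.rankOne p.1 p.2)
  set S := Submodule.span ℂ (Set.range fun p : X × X => T.p1 p.1 * star (T.p1 p.2))
  have hR : R ≤ c.toHilbertModule.compacts := R.le_topologicalClosure
  have hmap : ∀ k, (hk : k ∈ R) → Φ ⟨k, hR hk⟩ ∈ S := by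
    intro k hk
    induction hk using Submodule.span_induction with
    | mem k hk =>
      obtain ⟨⟨x, y⟩, rfl⟩ := hk
      rw [hΦ]
      exact Submodule.subset_span ⟨(x, y), rfl⟩
    | zero => exact (map_zero Φ).symm ▸ S.zero_mem
    | add k l hk hl hk' hl' =>
      exact (map_add Φ ⟨k, hR hk⟩ ⟨l, hR hl⟩).symm ▸ S.add_mem hk' hl'
    | smul z k hk hk' => exact (map_smul Φ z ⟨k, hR hk⟩).symm ▸ S.smul_mem z hk'
  have hdense : (⟨c.lact a, ha.1⟩ : c.toHilbertModule.compacts) ∈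
      closure {k : c.toHilbertModule.compacts | (k : X →L[ℂ] X) ∈ R} := by
    rw [closure_subtype]
    have himg : ((↑) : c.toHilbertModule.compacts → X →L[ℂ] X) ''
        {k : c.toHilbertModule.compacts | (k : X →L[ℂ] X) ∈ R}
        = R := by
      ext k
      exact ⟨fun ⟨_, hl, hlk⟩ => hlk ▸ hl, fun hk => ⟨⟨k, hR hk⟩, hk, rfl⟩⟩
    rw [himg]
    exact ha.1
  exact map_mem_closure Φ.continuous hdense fun k hk => hmap k hk

end ToeplitzPair

/-- If `π : O_X → B(H)` is a *-homomorphism and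
`φ : O_X → B(H)` is a completely positive completely contractive map agreeing
with `π` on `S(A,X)`, then for every `a ∈ J_X` and `x ∈ X`,
`φ(ι¹(a·x)ι¹(a·x)*) = φ(ι¹(a·x))φ(ι¹(a·x))*`; consequently `ι¹(a·x)` lies in
the multiplicative domain of `φ`. -/
theorem lact_katsura_mem_multiplicativeDomain
    {A : Type u} {X : Type v} [NonUnitalCStarAlgebra A] [NormedAddCommGroup X]
    [NormedSpace ℂ X] [CompleteSpace X] (c : Correspondence A X)
    (O : Type w) [NonUnitalCStarAlgebra O] (ι : ToeplitzPair c O)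
    (hO : IsCuntzPimsner c O ι)
    {H : Type u'} [NormedAddCommGroup H] [InnerProductSpace ℂ H] [CompleteSpace H]
    (π : O →⋆ₙₐ[ℂ] (H →L[ℂ] H)) (φ : O → H →L[ℂ] H) (hφ : IsCPCMap φ)
    (hagree : ∀ s ∈ SAX ι, φ s = π s) :
    ∀ a ∈ c.katsura, ∀ x : X,
      φ (ι.p1 (c.lact a x) * star (ι.p1 (c.lact a x)))
          = φ (ι.p1 (c.lact a x)) * star (φ (ι.p1 (c.lact a x))) ∧
      ∀ w : O, φ (ι.p1 (c.lact a x) * w) = φ (ι.p1 (c.lact a x)) * φ w ∧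
        φ (w * ι.p1 (c.lact a x)) = φ w * φ (ι.p1 (c.lact a x)) := by
  intro a ha x
  have hp0 : ∀ b, φ (ι.p0 b) = π (ι.p0 b) := fun b => hagree _ (ι.p0_mem_SAX b)
  have hp1 : ∀ y, φ (ι.p1 y) = π (ι.p1 y) := fun y => hagree _ (ι.p1_mem_SAX y)
  have p0_mul : ∀ b w, φ (ι.p0 b * w) = π (ι.p0 b) * φ w := by
    intro b w
    have h := hφ.map_star_mul (s := ι.p0 (star b))
      (by rw [← map_star, ← map_mul, hp0, hp0, map_mul, map_mul, map_star, map_star]) w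
    rwa [hp0, ← map_star, ← map_star, ← map_star, star_star] at h
  have star_p1_mul : ∀ y w, φ (star (ι.p1 y) * w) = star (π (ι.p1 y)) * φ w := by
    intro y w
    rw [← hp1]
    refine hφ.map_star_mul ?_ w
    rw [ι.star_p1_mul_p1, hp0, hp1, ← ι.star_p1_mul_p1, map_mul, map_star]
  have annihilates : ∀ w, ∀ k ∈ (Submodule.span ℂ
      (Set.range fun p : X × X => ι.p1 p.1 * star (ι.p1 p.2))).topologicalClosure,
      π k * (φ (ι.p1 x * w) - π (ι.p1 x) * φ w) = 0 := by
    intro w k hk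
    have hπ : Continuous π := AddMonoidHomClass.continuous_of_bound π 1 fun w => by
      simpa using NonUnitalStarAlgHom.norm_apply_le π w
    refine closure_minimal (fun k hk => ?_)
      (isClosed_singleton.preimage (hπ.mul continuous_const)) hk
    change π k * (φ (ι.p1 x * w) - π (ι.p1 x) * φ w) = 0
    induction hk using Submodule.span_induction with
    | mem k hk =>
      obtain ⟨⟨y, z⟩, rfl⟩ := hk
      have h : star (π (ι.p1 z)) * (φ (ι.p1 x * w) - π (ι.p1 x) * φ w) = 0 := by
        rw [mul_sub, ← star_p1_mul, ← mul_assoc, ← mul_assoc, ι.star_p1_mul_p1, p0_mul,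
          ← ι.star_p1_mul_p1, map_mul, map_star, sub_self]
      rw [map_mul, map_star, mul_assoc, h, mul_zero]
    | zero => rw [map_zero, zero_mul]
    | add k l _ _ hk hl => rw [map_add, add_mul, hk, hl, add_zero]
    | smul z k _ hk => rw [map_smul, smul_mul_assoc, hk, smul_zero]
  have left : ∀ w, φ (ι.p1 (c.lact a x) * w) = φ (ι.p1 (c.lact a x)) * φ w := by
    intro w
    have h := annihilates w _ (hO.covariant.p0_mem_closure ha)
    rw [mul_sub, sub_eq_zero, ← p0_mul, ← mul_assoc, ← mul_assoc, ← map_mul,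
      ι.p0_mul_p1] at h
    rw [h, hp1]
  refine ⟨by rw [left, hφ.map_star], fun w => ⟨left w, ?_⟩⟩
  have h := congrArg star (star_p1_mul (c.lact a x) (star w))
  rwa [← hφ.map_star, star_mul, star_mul, star_star, star_star, hφ.map_star, star_star,
    ← hp1, star_star] at h

end
end

section
/- Let (A,X) be a C*-correspondence, a ∈ J_X, and let Y be a countably generated closed A-submodule of X with standard normalized frame (x_k(Y))_{k≥1}; for each k, a·x_k(Y) denotes the element of X corresponding to the compact operator λ(a)∘x_k(Y): A → X. Then in O_X: for every ε > 0 there exist a countably generated closed A-submodule Y of X with standard normalized frame (x_k(Y)) and an n ∈ ℕ such that ‖ι⁰(aa*) − Σ_{k=1}^{n} ι¹(a·x_k(Y))·ι¹(a·x_k(Y))*‖ < ε; that is, ι⁰(aa*) is the iterated limit over Y and n of these finite sums. -/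
/-!
Common framework: Hilbert C*-modules, C*-correspondences, compact operators,
the Katsura ideal, Toeplitz pairs, covariance, Cuntz-Pimsner algebras,
completely positive completely contractive maps, and hyperrigidity.
-/

noncomputable section

open Filter Topology Set
open scoped ComplexOrder InnerProductSpace

universe u v w u'

/-- An element of the multiplier module `M(Y) = L(A, Y)` of a submodule
`Y ⊆ X`: an adjointable operator from `A` (viewed as a Hilbert `A`-module over
itself) to `Y ⊆ X`.  `toFun a` is the value `x·a ∈ Y` and `adj z = ⟨x, z⟩ ∈ A`
is the adjoint, so that `⟨x·a, z⟩ = a* * ⟨x, z⟩` (adjointable operators are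
automatically bounded and linear; we record these facts as fields). -/
structure Multiplier {A : Type u} {X : Type v} [NonUnitalCStarAlgebra A]
    [NormedAddCommGroup X] [NormedSpace ℂ X] [CompleteSpace X]
    (M : HilbertModule A X) (Y : Submodule ℂ X) : Type (max u v) where
  toFun : A → X
  adj : X → A
  mem_toFun : ∀ a, toFun a ∈ Y
  toFun_add : ∀ a b, toFun (a + b) = toFun a + toFun b
  toFun_csmul : ∀ (z : ℂ) a, toFun (z • a) = z • toFun a
  toFun_mul : ∀ a b, toFun (a * b) = M.smulR (toFun a) b
  adj_add : ∀ x y, adj (x + y) = adj x + adj y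
  adj_csmul : ∀ (z : ℂ) x, adj (z • x) = z • adj x
  adjoint : ∀ a x, M.inner (toFun a) x = star a * adj x
  continuous_toFun : Continuous toFun
  continuous_adj : Continuous adj

/-- `Y` is a closed right-`A`-submodule of the Hilbert module `X`. -/
structure IsClosedSubmodule {A : Type u} {X : Type v} [NonUnitalCStarAlgebra A]
    [NormedAddCommGroup X] [NormedSpace ℂ X] [CompleteSpace X]
    (M : HilbertModule A X) (Y : Submodule ℂ X) : Prop where
  isClosed : IsClosed (Y : Set X)
  smulR_mem : ∀ x ∈ Y, ∀ a, M.smulR x a ∈ Y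

/-- `Y` is countably generated over `A`: there is a sequence in `M(Y)` whose
`A`-linear span is dense in `Y`. -/
def IsCountablyGenerated {A : Type u} {X : Type v} [NonUnitalCStarAlgebra A]
    [NormedAddCommGroup X] [NormedSpace ℂ X] [CompleteSpace X]
    (M : HilbertModule A X) (Y : Submodule ℂ X) : Prop :=
  ∃ xs : ℕ → Multiplier M Y,
    (Y : Set X) ⊆
      closure ((Submodule.span ℂ {w : X | ∃ n a, w = (xs n).toFun a} : Submodule ℂ X) : Set X)

/-- `(xs n)` is a standard normalized frame for `Y`: for every `y ∈ Y` the
reconstruction formula `y = ∑_{n ≥ 1} x_n·⟨x_n, y⟩` holds. -/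
def IsFrame {A : Type u} {X : Type v} [NonUnitalCStarAlgebra A]
    [NormedAddCommGroup X] [NormedSpace ℂ X] [CompleteSpace X]
    (M : HilbertModule A X) (Y : Submodule ℂ X) (xs : ℕ → Multiplier M Y) : Prop :=
  ∀ y ∈ Y, Tendsto (fun n => ∑ j ∈ Finset.range n, (xs j).toFun ((xs j).adj y))
    atTop (𝓝 y)

section Residual

variable {U : Type*} [CStarAlgebra U]

/-- The residuals `r₀ = 1`, `r_{n+1} = r_n - r_n t r_n` of the frame construction. -/
def frameResidual (t : U) : ℕ → U
  | 0 => 1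
  | n + 1 => frameResidual t n - frameResidual t n * t * frameResidual t n

/-- The scalar version of `frameResidual`. -/
def scalarResidual : ℕ → ℝ → ℝ
  | 0 => fun _ => 1
  | n + 1 => fun x => scalarResidual n x - scalarResidual n x * x * scalarResidual n x

theorem continuous_scalarResidual (n : ℕ) : Continuous (scalarResidual n) := by
  induction n with
  | zero => exact continuous_const
  | succ n ih => exact ih.sub ((ih.mul continuous_id).mul ih)

theorem scalarResidual_bounds (n : ℕ) {x : ℝ} (h0 : 0 ≤ x) (h1 : x ≤ 1) :
    0 ≤ scalarResidual n x ∧ scalarResidual n x ≤ 1 ∧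
      scalarResidual n x * (1 + n * x) ≤ 1 := by
  induction n with
  | zero => simp [scalarResidual]
  | succ n ih =>
    obtain ⟨hf0, hf1, hf⟩ := ih
    simp only [scalarResidual]
    set f := scalarResidual n x
    have hv0 : 0 ≤ f * x := mul_nonneg hf0 h0
    have hv1 : f * x ≤ 1 := mul_le_one₀ hf1 h0 h1
    push_cast
    refine ⟨by nlinarith, by nlinarith, ?_⟩
    have : (1 - f * x) * (f * (1 + n * x) + f * x) ≤ (1 - f * x) * (1 + f * x) :=
      mul_le_mul_of_nonneg_left (by linarith) (by linarith)
    nlinarith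

theorem scalarResidual_conj_le (n : ℕ) {x : ℝ} (h0 : 0 ≤ x) (h1 : x ≤ 1) :
    scalarResidual n x * x * scalarResidual n x ≤ 1 / ((n : ℝ) + 1) := by
  obtain ⟨hf0, hf1, hf⟩ := scalarResidual_bounds n h0 h1
  set f := scalarResidual n x
  have hn : (0 : ℝ) ≤ n := n.cast_nonneg
  rw [le_div_iff₀ (by positivity)]
  have h2 : f * x * (n + 1) ≤ 1 := by nlinarith
  have h3 : 0 ≤ f * x * (n + 1) := by positivity
  nlinarith

theorem frameResidual_eq_cfc {t : U} (ht : IsSelfAdjoint t) (n : ℕ) :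
    frameResidual t n = cfc (scalarResidual n) t := by
  induction n with
  | zero => exact (cfc_one ℝ t ht).symm
  | succ n ih =>
    have hc := (continuous_scalarResidual n).continuousOn (s := spectrum ℝ t)
    simp only [frameResidual, scalarResidual]
    rw [cfc_sub _ _ t hc (by fun_prop), cfc_mul _ _ t (by fun_prop) hc,
      cfc_mul _ _ t hc (by fun_prop), cfc_id' ℝ t ht, ih]

theorem isSelfAdjoint_frameResidual {t : U} (ht : IsSelfAdjoint t) (n : ℕ) :
    IsSelfAdjoint (frameResidual t n) := by
  rw [frameResidual_eq_cfc ht]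
  exact cfc_predicate _ _

theorem sum_frameResidual_conj (t : U) (n : ℕ) :
    ∑ j ∈ Finset.range n, frameResidual t j * t * frameResidual t j
      = 1 - frameResidual t n := by
  induction n with
  | zero => simp [frameResidual]
  | succ n ih =>
    rw [Finset.sum_range_succ, ih, frameResidual]
    abel

variable [PartialOrder U] [StarOrderedRing U]

theorem mem_Icc_of_mem_spectrum {t : U} (h0 : 0 ≤ t) (h1 : ‖t‖ ≤ 1) {x : ℝ}
    (hx : x ∈ spectrum ℝ t) : x ∈ Icc (0 : ℝ) 1 := by
  rcases subsingleton_or_nontrivial U with _ | _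
  · simp at hx
  · exact ⟨spectrum_nonneg_of_nonneg h0 hx,
      (Real.le_norm_self x).trans ((spectrum.norm_le_norm_of_mem hx).trans h1)⟩

theorem frameResidual_nonneg {t : U} (h0 : 0 ≤ t) (h1 : ‖t‖ ≤ 1) (n : ℕ) :
    0 ≤ frameResidual t n := by
  rw [frameResidual_eq_cfc h0.isSelfAdjoint]
  refine cfc_nonneg fun x hx => ?_
  have hx := mem_Icc_of_mem_spectrum h0 h1 hx
  exact (scalarResidual_bounds n hx.1 hx.2).1

theorem norm_frameResidual_conj_le {t : U} (h0 : 0 ≤ t) (h1 : ‖t‖ ≤ 1) (n : ℕ) :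
    ‖frameResidual t n * t * frameResidual t n‖ ≤ 1 / ((n : ℝ) + 1) := by
  have ht := h0.isSelfAdjoint
  have hc := (continuous_scalarResidual n).continuousOn (s := spectrum ℝ t)
  have : frameResidual t n * t * frameResidual t n
      = cfc (fun x => scalarResidual n x * x * scalarResidual n x) t := by
    rw [cfc_mul _ _ t (by fun_prop) hc, cfc_mul _ _ t hc (by fun_prop), cfc_id' ℝ t ht,
      frameResidual_eq_cfc ht]
  rw [this]
  refine norm_cfc_le (by positivity) fun x hx => ?_
  obtain ⟨hx0, hx1⟩ := mem_Icc_of_mem_spectrum h0 h1 hx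
  have hf0 := (scalarResidual_bounds n hx0 hx1).1
  rw [Real.norm_of_nonneg (by positivity)]
  exact scalarResidual_conj_le n hx0 hx1

/-- If `η η* ≤ t`, the residuals of `t` annihilate `η` in the limit. -/
theorem tendsto_frameResidual_mul {t : U} (h1 : ‖t‖ ≤ 1) {η : U}
    (hη : η * star η ≤ t) : Tendsto (fun n => frameResidual t n * η) atTop (𝓝 0) := by
  have h0 : 0 ≤ t := (mul_star_self_nonneg η).trans hη
  have key : ∀ n, ‖frameResidual t n * η‖ * ‖frameResidual t n * η‖ ≤ 1 / ((n : ℝ) + 1) := by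
    intro n
    have hr := (isSelfAdjoint_frameResidual h0.isSelfAdjoint n)
    rw [← CStarRing.norm_self_mul_star, star_mul, hr.star_eq]
    have : frameResidual t n * η * (star η * frameResidual t n)
        ≤ frameResidual t n * t * frameResidual t n := by
      simpa [mul_assoc, hr.star_eq] using star_right_conjugate_le_conjugate hη (frameResidual t n)
    refine (CStarAlgebra.norm_le_norm_of_nonneg_of_le ?_ this).trans
      (norm_frameResidual_conj_le h0 h1 n)
    simpa [hr.star_eq] using mul_star_self_nonneg (frameResidual t n * η)
  rw [tendsto_zero_iff_norm_tendsto_zero]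
  have h2 := (squeeze_zero (fun n => mul_self_nonneg _) key
    tendsto_one_div_add_atTop_nhds_zero_nat).sqrt
  simpa [Real.sqrt_mul_self] using h2

theorem norm_mul_sq_le {d η : U} (h0 : 0 ≤ d) (h1 : d ≤ 1) :
    ‖d * η‖ * ‖d * η‖ ≤ ‖star η * d * η‖ := by
  rw [← CStarRing.norm_star_mul_self, star_mul, h0.isSelfAdjoint.star_eq]
  have hdd : d * d ≤ d := by
    have := CStarAlgebra.pow_antitone h0 h1 (show 1 ≤ 2 by norm_num)
    simpa [sq] using this
  refine CStarAlgebra.norm_le_norm_of_nonneg_of_le ?_ ?_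
  · simpa [h0.isSelfAdjoint.star_eq] using star_mul_self_nonneg (d * η)
  · simpa [mul_assoc] using star_left_conjugate_le_conjugate hdd η

section Frame

variable (m : ℕ) (η : ℕ → U)

/-- The elements `r_q η_i`, enumerated as `k = m q + i`. -/
def frameElem (k : ℕ) : U :=
  frameResidual (∑ i ∈ Finset.range m, η i * star (η i)) (k / m) * η (k % m)

/-- The defects `1 - ∑_{k<n} ξ_k ξ_k*` of the frame. -/
def frameDefect (n : ℕ) : U :=
  1 - ∑ k ∈ Finset.range n, frameElem m η k * star (frameElem m η k)

variable {m η}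

theorem antitone_frameDefect : Antitone (frameDefect m η) := by
  refine antitone_nat_of_succ_le fun n => ?_
  rw [frameDefect, frameDefect, Finset.sum_range_succ]
  exact sub_le_sub_left (le_add_of_nonneg_right (mul_star_self_nonneg _)) _

theorem frameDefect_le_one (n : ℕ) : frameDefect m η n ≤ 1 :=
  sub_le_self _ (Finset.sum_nonneg fun _ _ => mul_star_self_nonneg _)

theorem frameDefect_mul (hm : 0 < m) (q : ℕ) :
    frameDefect m η (m * q)
      = frameResidual (∑ i ∈ Finset.range m, η i * star (η i)) q := by
  set t := ∑ i ∈ Finset.range m, η i * star (η i) with ht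
  have h0 : IsSelfAdjoint t :=
    (Finset.sum_nonneg fun _ _ => mul_star_self_nonneg (η _)).isSelfAdjoint
  have : ∑ k ∈ Finset.range (m * q), frameElem m η k * star (frameElem m η k)
      = ∑ j ∈ Finset.range q, frameResidual t j * t * frameResidual t j := by
    induction q with
    | zero => simp
    | succ q ih =>
      rw [Nat.mul_succ, Finset.sum_range_add, ih, Finset.sum_range_succ]
      congr 1
      nth_rewrite 3 [ht]
      rw [Finset.mul_sum, Finset.sum_mul]
      refine Finset.sum_congr rfl fun i hi => ?_
      have hi := Finset.mem_range.1 hi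
      rw [frameElem, Nat.mul_add_div hm, Nat.div_eq_of_lt hi, Nat.mul_add_mod,
        Nat.mod_eq_of_lt hi, star_mul, (isSelfAdjoint_frameResidual h0 _).star_eq]
      simp [mul_assoc, ht]
  rw [frameDefect, this, sum_frameResidual_conj, sub_sub_cancel]

theorem frameDefect_nonneg (hm : 0 < m)
    (h1 : ‖∑ i ∈ Finset.range m, η i * star (η i)‖ ≤ 1) (n : ℕ) : 0 ≤ frameDefect m η n := by
  have h0 : 0 ≤ ∑ i ∈ Finset.range m, η i * star (η i) :=
    Finset.sum_nonneg fun _ _ => mul_star_self_nonneg _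
  have h2 := frameResidual_nonneg h0 h1 n
  rw [← frameDefect_mul hm] at h2
  exact h2.trans (antitone_frameDefect (Nat.le_mul_of_pos_left n hm))

theorem norm_frameDefect_le (hm : 0 < m)
    (h1 : ‖∑ i ∈ Finset.range m, η i * star (η i)‖ ≤ 1) (n : ℕ) : ‖frameDefect m η n‖ ≤ 1 :=
  (CStarAlgebra.norm_le_one_iff_of_nonneg _ (frameDefect_nonneg hm h1 n)).2
    (frameDefect_le_one n)

theorem tendsto_frameDefect_mul (hm : 0 < m)
    (h1 : ‖∑ i ∈ Finset.range m, η i * star (η i)‖ ≤ 1) {i : ℕ} (hi : i < m) :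
    Tendsto (fun n => frameDefect m η n * η i) atTop (𝓝 0) := by
  have hle : η i * star (η i) ≤ ∑ i ∈ Finset.range m, η i * star (η i) :=
    Finset.single_le_sum (f := fun i => η i * star (η i))
      (fun _ _ => mul_star_self_nonneg _) (Finset.mem_range.2 hi)
  have hr := (tendsto_frameResidual_mul h1 hle).norm.const_mul ‖η i‖
  simp only [norm_zero, mul_zero] at hr
  have hr := (hr.comp (Nat.tendsto_div_const_atTop hm.ne')).sqrt
  rw [tendsto_zero_iff_norm_tendsto_zero]
  refine squeeze_zero (fun _ => norm_nonneg _) (fun n => ?_) 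
    (by simpa only [Real.sqrt_zero] using hr)
  refine Real.le_sqrt_of_sq_le ?_
  rw [sq]
  refine (norm_mul_sq_le (frameDefect_nonneg hm h1 n) (frameDefect_le_one n)).trans ?_
  have hd : frameDefect m η n ≤ frameDefect m η (m * (n / m)) :=
    antitone_frameDefect (Nat.mul_div_le n m)
  refine (CStarAlgebra.norm_le_norm_of_nonneg_of_le
    (star_left_conjugate_nonneg (frameDefect_nonneg hm h1 n) _)
    (star_left_conjugate_le_conjugate hd (η i))).trans ?_
  rw [frameDefect_mul hm, mul_assoc]
  exact (norm_mul_le _ _).trans (by rw [norm_star]; rfl)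

end Frame

end Residual

namespace HilbertModule

variable {A : Type u} {X : Type v} [NonUnitalCStarAlgebra A]
  [NormedAddCommGroup X] [NormedSpace ℂ X] [CompleteSpace X] (M : HilbertModule A X)

theorem inner_smulR_left (x z : X) (b : A) :
    M.inner (M.smulR x b) z = star b * M.inner x z := by
  rw [← M.star_inner, M.inner_smulR_right, star_mul, M.star_inner]

theorem inner_csmul_left (s : ℂ) (x y : X) :
    M.inner (s • x) y = star s • M.inner x y := by
  rw [← M.star_inner, M.inner_csmul_right, star_smul, M.star_inner]

/-- The right action `x ↦ x·b` as a continuous linear map. -/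
def smulRL (b : A) : X →L[ℂ] X :=
  LinearMap.mkContinuous
    { toFun := fun x => M.smulR x b
      map_add' := fun x y => M.smulR_add_left x y b
      map_smul' := fun s x => M.smulR_csmul_left s x b }
    ‖b‖ fun x => (M.norm_smulR_le x b).trans_eq (mul_comm _ _)

@[simp]
theorem smulRL_apply (b : A) (x : X) : M.smulRL b x = M.smulR x b := rfl

theorem rankOne_apply (x y z : X) : M.rankOne x y z = M.smulR x (M.inner y z) := rfl

theorem rankOne_csmul_left (s : ℂ) (x y : X) : M.rankOne (s • x) y = s • M.rankOne x y := by
  ext z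
  simp [rankOne_apply, M.smulR_csmul_left]

theorem rankOne_csmul_right (s : ℂ) (x y : X) :
    M.rankOne x (s • y) = star s • M.rankOne x y := by
  ext z
  simp [rankOne_apply, M.inner_csmul_left, M.smulR_csmul_right]

theorem exists_eq_sum_rankOne {S : X →L[ℂ] X}
    (hS : S ∈ Submodule.span ℂ (Set.range fun p : X × X => M.rankOne p.1 p.2)) :
    ∃ m, 0 < m ∧ ∃ z y : ℕ → X, S = ∑ i ∈ Finset.range m, M.rankOne (z i) (y i) := by
  induction hS using Submodule.span_induction with
  | mem S h =>
    obtain ⟨p, rfl⟩ := h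
    exact ⟨1, one_pos, fun _ => p.1, fun _ => p.2, by simp⟩
  | zero =>
    refine ⟨1, one_pos, 0, 0, ?_⟩
    simpa using (M.rankOne_csmul_left 0 0 0).symm
  | add S S' _ _ h h' =>
    obtain ⟨m, hm, z, y, rfl⟩ := h
    obtain ⟨m', -, z', y', rfl⟩ := h'
    refine ⟨m + m', by omega, fun i => if i < m then z i else z' (i - m),
      fun i => if i < m then y i else y' (i - m), ?_⟩
    rw [Finset.sum_range_add]
    congr 1
    · refine Finset.sum_congr rfl fun i hi => ?_
      simp [Finset.mem_range.1 hi]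
    · simp
  | smul s S _ h =>
    obtain ⟨m, hm, z, y, rfl⟩ := h
    exact ⟨m, hm, fun i => s • z i, y, by simp [rankOne_csmul_left, Finset.smul_sum]⟩

theorem exists_eq_sum_rankOne_of_sum_sq_le {S : X →L[ℂ] X}
    (hS : S ∈ Submodule.span ℂ (Set.range fun p : X × X => M.rankOne p.1 p.2)) :
    ∃ m, 0 < m ∧ ∃ z y : ℕ → X, S = ∑ i ∈ Finset.range m, M.rankOne (z i) (y i) ∧
      ∑ i ∈ Finset.range m, ‖y i‖ * ‖y i‖ ≤ 1 := by
  obtain ⟨m, hm, z, y, rfl⟩ := M.exists_eq_sum_rankOne hS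
  set C := ∑ i ∈ Finset.range m, ‖y i‖ * ‖y i‖ with hC
  have hC0 : 0 ≤ C := Finset.sum_nonneg fun _ _ => mul_self_nonneg _
  have hs : 0 < 1 + C := by linarith
  refine ⟨m, hm, fun i => ((1 + C : ℝ) : ℂ) • z i, fun i => (((1 + C)⁻¹ : ℝ) : ℂ) • y i, ?_, ?_⟩
  · refine Finset.sum_congr rfl fun i _ => ?_
    rw [rankOne_csmul_left, rankOne_csmul_right, smul_smul, Complex.star_def, Complex.conj_ofReal,
      ← Complex.ofReal_mul, mul_inv_cancel₀ hs.ne', Complex.ofReal_one, one_smul]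
  · have : ∀ i, ‖(((1 + C)⁻¹ : ℝ) : ℂ) • y i‖ * ‖(((1 + C)⁻¹ : ℝ) : ℂ) • y i‖
        = (1 + C)⁻¹ * (1 + C)⁻¹ * (‖y i‖ * ‖y i‖) := by
      intro i
      rw [norm_smul, Complex.norm_real, Real.norm_of_nonneg (inv_nonneg.2 hs.le)]
      ring
    simp only [this]
    rw [← Finset.mul_sum, ← hC, ← mul_inv, inv_mul_le_one₀ (by positivity)]
    nlinarith

/-- The closed submodule generated by `y_0, …, y_{m-1}` under the right action. -/
def generated (m : ℕ) (y : ℕ → X) : Submodule ℂ X :=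
  (Submodule.span ℂ {z | ∃ i < m, ∃ b, z = M.smulR (y i) b}).topologicalClosure

theorem smulR_mem_generated {m : ℕ} (y : ℕ → X) {i : ℕ} (hi : i < m) (b : A) :
    M.smulR (y i) b ∈ M.generated m y :=
  Submodule.le_topologicalClosure _ (Submodule.subset_span ⟨i, hi, b, rfl⟩)

theorem isClosedSubmodule_generated (m : ℕ) (y : ℕ → X) :
    IsClosedSubmodule M (M.generated m y) where
  isClosed := Submodule.isClosed_topologicalClosure _
  smulR_mem x hx b := by
    have hle : Submodule.span ℂ {z | ∃ i < m, ∃ b, z = M.smulR (y i) b}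
        ≤ (M.generated m y).comap (M.smulRL b).toLinearMap := by
      refine Submodule.span_le.2 ?_
      rintro _ ⟨i, hi, b', rfl⟩
      simpa [M.smulR_mul] using M.smulR_mem_generated y hi (b' * b)
    exact Submodule.topologicalClosure_minimal _ hle
      ((Submodule.isClosed_topologicalClosure _).preimage (M.smulRL b).continuous) hx

/-- An element `x` with `x·A ⊆ Y`, viewed as the multiplier `b ↦ x·b`. -/
def toMultiplier {Y : Submodule ℂ X} (x : X) (hx : ∀ b, M.smulR x b ∈ Y) : Multiplier M Y where
  toFun := M.smulR x
  adj := M.inner x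
  mem_toFun := hx
  toFun_add := M.smulR_add_right x
  toFun_csmul z a := M.smulR_csmul_right z x a
  toFun_mul a b := (M.smulR_mul x a b).symm
  adj_add := M.inner_add_right x
  adj_csmul z y := M.inner_csmul_right z x y
  adjoint a y := M.inner_smulR_left x y a
  continuous_toFun :=
    (LinearMap.mkContinuous
      ({ toFun := M.smulR x
         map_add' := M.smulR_add_right x
         map_smul' := fun s b => M.smulR_csmul_right s x b } : A →ₗ[ℂ] X)
      ‖x‖ (M.norm_smulR_le x)).continuous
  continuous_adj :=
    (LinearMap.mkContinuous
      ({ toFun := M.inner x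
         map_add' := M.inner_add_right x
         map_smul' := fun s y => M.inner_csmul_right s x y } : X →ₗ[ℂ] A)
      ‖x‖ (M.norm_inner_le x)).continuous

theorem isCountablyGenerated_generated {m : ℕ} (hm : 0 < m) (y : ℕ → X) :
    IsCountablyGenerated M (M.generated m y) := by
  refine ⟨fun n => M.toMultiplier (y (n % m))
    (M.smulR_mem_generated y (Nat.mod_lt n hm)), closure_mono (Submodule.span_mono ?_)⟩
  rintro _ ⟨i, hi, b, rfl⟩
  exact ⟨i, b, by simp [toMultiplier, Nat.mod_eq_of_lt hi]⟩

/-- The vectors `R_n y_i`, where `R_0 = 1`, `R_{n+1} = R_n - R_n T R_n` and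
`T = ∑_{l<m} θ_{y_l,y_l}`. -/
def residualVec (m : ℕ) (y : ℕ → X) : ℕ → ℕ → X
  | 0 => y
  | n + 1 => fun i => residualVec m y n i -
      ∑ l ∈ Finset.range m, M.smulR (residualVec m y n l) (M.inner (residualVec m y n l) (y i))

theorem smulR_residualVec_mem {m : ℕ} (y : ℕ → X) (n : ℕ) {i : ℕ} (hi : i < m) (b : A) :
    M.smulR (M.residualVec m y n i) b ∈ M.generated m y := by
  induction n generalizing i b with
  | zero => exact M.smulR_mem_generated y hi b
  | succ n ih =>
    rw [residualVec, ← smulRL_apply, map_sub, map_sum]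
    refine Submodule.sub_mem _ (ih hi b) (Submodule.sum_mem _ fun l hl => ?_)
    rw [smulRL_apply, M.smulR_mul]
    exact ih (Finset.mem_range.1 hl) _

/-- The frame `(R_q y_i)`, enumerated as `k = m q + i`, of the submodule generated by
`y_0, …, y_{m-1}`. -/
def frameMultiplier {m : ℕ} (hm : 0 < m) (y : ℕ → X) (k : ℕ) : Multiplier M (M.generated m y) :=
  M.toMultiplier (M.residualVec m y (k / m) (k % m))
    (M.smulR_residualVec_mem y _ (Nat.mod_lt k hm))

end HilbertModule

namespace ToeplitzPair

variable {A : Type u} {X : Type v} [NonUnitalCStarAlgebra A]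
  [NormedAddCommGroup X] [NormedSpace ℂ X] [CompleteSpace X] {c : Correspondence A X}

section NonUnital

variable {C : Type*} {D : Type*} [NonUnitalCStarAlgebra C] [NonUnitalCStarAlgebra D]

/-- The composition of a Toeplitz pair with a *-homomorphism. -/
def map (T : ToeplitzPair c C) (ρ : C →⋆ₙₐ[ℂ] D) : ToeplitzPair c D where
  p0 := ρ.comp T.p0
  p1 := (ρ : C →ₗ[ℂ] D).comp T.p1
  p0_mul_p1 a x := by simp [← map_mul, T.p0_mul_p1]
  star_p1_mul_p1 x y := by simp [← map_mul, ← map_star, T.star_p1_mul_p1]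

theorem IsCovariant.map {T : ToeplitzPair c C} (hT : T.IsCovariant) (ρ : C →⋆ₙₐ[ℂ] D) :
    (T.map ρ).IsCovariant := by
  obtain ⟨Φ, h1, h2⟩ := hT
  let ρL : C →L[ℂ] D := LinearMap.mkContinuous (ρ : C →ₗ[ℂ] D) 1 fun x => by
    simpa using NonUnitalStarAlgHom.norm_apply_le ρ x
  refine ⟨ρL.comp Φ, fun x y => ?_, fun a ha => ?_⟩
  · simp [h1, ρL, ToeplitzPair.map, map_star]
  · simp [ToeplitzPair.map, h2 a ha, ρL]

theorem IsCovariant.exists_norm_sub_sum_le {T : ToeplitzPair c C} (hT : T.IsCovariant) :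
    ∃ K : ℝ, 0 ≤ K ∧ ∀ a ∈ c.katsura, ∀ (m : ℕ) (z y : ℕ → X),
      ‖T.p0 a - ∑ i ∈ Finset.range m, T.p1 (z i) * star (T.p1 (y i))‖
        ≤ K * ‖c.lact a - ∑ i ∈ Finset.range m, c.rankOne (z i) (y i)‖ := by
  obtain ⟨Φ, hΦ, hΦa⟩ := hT
  obtain ⟨K, hK0, hK⟩ :=
    ContinuousLinearMap.bound (E := c.compacts) (F := C) (σ₁₂ := RingHom.id ℂ) Φ
  refine ⟨K, hK0.le, fun a ha m z y => ?_⟩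
  have hsum : ∑ i ∈ Finset.range m, T.p1 (z i) * star (T.p1 (y i)) = Φ (∑ i ∈ Finset.range m,
      ⟨c.rankOne (z i) (y i), c.rankOne_mem_compacts (z i) (y i)⟩) := by
    simp only [map_sum, hΦ]
  rw [hsum, hΦa a ha, ← map_sub]
  refine (hK _).trans_eq ?_
  simp

variable (T : ToeplitzPair c C)

theorem p1_smulR (x : X) (b : A) : T.p1 (c.smulR x b) = T.p1 x * T.p0 b := by
  rw [← sub_eq_zero, ← CStarRing.star_mul_self_eq_zero_iff]
  simp only [star_sub, star_mul, sub_mul, mul_sub, T.star_p1_mul_p1, ← mul_assoc]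
  simp only [mul_assoc, T.star_p1_mul_p1]
  simp only [← mul_assoc]
  simp only [← map_star, ← map_mul, HilbertModule.inner_smulR_left,
    HilbertModule.inner_smulR_right, mul_assoc]
  abel

theorem norm_p1 (hT : Function.Injective T.p0) (x : X) : ‖T.p1 x‖ = ‖x‖ := by
  have h : ‖T.p1 x‖ * ‖T.p1 x‖ = ‖x‖ * ‖x‖ := by
    rw [← CStarRing.norm_star_mul_self, T.star_p1_mul_p1, NonUnitalStarAlgHom.norm_map T.p0 hT,
      ← c.norm_sq_eq_norm_inner_self, sq]
  exact (mul_self_inj (norm_nonneg _) (norm_nonneg _)).1 h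

end NonUnital

section Unital

variable {U : Type*} [CStarAlgebra U] (T : ToeplitzPair c U)

theorem p1_residualVec (m : ℕ) (y : ℕ → X) (n i : ℕ) :
    T.p1 (c.residualVec m y n i)
      = frameResidual (∑ i ∈ Finset.range m, T.p1 (y i) * star (T.p1 (y i))) n * T.p1 (y i) := by
  induction n generalizing i with
  | zero => simp [HilbertModule.residualVec, frameResidual]
  | succ n ih =>
    set t := ∑ i ∈ Finset.range m, T.p1 (y i) * star (T.p1 (y i)) with ht
    have hr : IsSelfAdjoint (frameResidual t n) := by
      refine isSelfAdjoint_frameResidual ?_ n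
      simp [IsSelfAdjoint, ht, star_sum]
    have hsum : frameResidual t n * t * frameResidual t n * T.p1 (y i)
        = ∑ l ∈ Finset.range m, T.p1 (c.residualVec m y n l) *
          (star (T.p1 (c.residualVec m y n l)) * T.p1 (y i)) := by
      nth_rewrite 2 [ht]
      simp only [ih, star_mul, hr.star_eq, Finset.mul_sum, Finset.sum_mul, mul_assoc]
    rw [HilbertModule.residualVec, frameResidual, sub_mul, hsum, map_sub, map_sum, ih]
    simp only [p1_smulR, T.star_p1_mul_p1]

theorem p1_frame {m : ℕ} (y : ℕ → X) (k : ℕ) :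
    T.p1 (c.residualVec m y (k / m) (k % m)) = frameElem m (fun i => T.p1 (y i)) k :=
  T.p1_residualVec m y _ _

variable {T}

theorem norm_sum_p1_mul_star_le (hT : Function.Injective T.p0) {m : ℕ} {y : ℕ → X}
    (hy : ∑ i ∈ Finset.range m, ‖y i‖ * ‖y i‖ ≤ 1) :
    ‖∑ i ∈ Finset.range m, T.p1 (y i) * star (T.p1 (y i))‖ ≤ 1 := by
  refine (norm_sum_le _ _).trans (le_trans (Finset.sum_le_sum fun i _ => ?_) hy)
  rw [CStarRing.norm_self_mul_star, T.norm_p1 hT]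

theorem p0_sub_sum_eq (a : A) {m : ℕ} (y : ℕ → X) (n : ℕ) :
    T.p0 (a * star a) - ∑ k ∈ Finset.range n,
      T.p1 (c.lact a (c.residualVec m y (k / m) (k % m))) *
        star (T.p1 (c.lact a (c.residualVec m y (k / m) (k % m))))
      = T.p0 a * frameDefect m (fun i => T.p1 (y i)) n * star (T.p0 a) := by
  simp only [← T.p0_mul_p1, p1_frame, frameDefect, mul_sub, sub_mul, mul_one, Finset.mul_sum,
    Finset.sum_mul, star_mul, map_mul, map_star, mul_assoc]

variable [PartialOrder U] [StarOrderedRing U]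

theorem tendsto_frameDefect_mul_p1 (hT : Function.Injective T.p0) {m : ℕ} (hm : 0 < m)
    {y : ℕ → X} (hy : ∑ i ∈ Finset.range m, ‖y i‖ * ‖y i‖ ≤ 1) {x : X}
    (hx : x ∈ c.generated m y) :
    Tendsto (fun n => frameDefect m (fun i => T.p1 (y i)) n * T.p1 x) atTop (𝓝 0) := by
  have h1 := norm_sum_p1_mul_star_le hT hy
  have hspan : ∀ z ∈ Submodule.span ℂ {z | ∃ i < m, ∃ b, z = c.smulR (y i) b},
      Tendsto (fun n => frameDefect m (fun i => T.p1 (y i)) n * T.p1 z) atTop (𝓝 0) := by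
    intro z hz
    induction hz using Submodule.span_induction with
    | mem z h =>
      obtain ⟨i, hi, b, rfl⟩ := h
      simpa [p1_smulR, mul_assoc] using
        (tendsto_frameDefect_mul (η := fun i => T.p1 (y i)) hm h1 hi).mul_const (T.p0 b)
    | zero => simp
    | add z z' _ _ h h' => simpa [mul_add] using h.add h'
    | smul s z _ h => simpa using h.const_smul s
  rw [Metric.tendsto_atTop]
  intro ε hε
  obtain ⟨z, hz, hxz⟩ := Metric.mem_closure_iff.1 hx (ε / 2) (half_pos hε)
  obtain ⟨N, hN⟩ := Metric.tendsto_atTop.1 (hspan z hz) (ε / 2) (half_pos hε)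
  refine ⟨N, fun n hn => ?_⟩
  have hn := hN n hn
  rw [dist_zero_right] at hn ⊢
  rw [dist_eq_norm] at hxz
  set d := frameDefect m (fun i => T.p1 (y i)) n with hd
  have hd1 : ‖d‖ ≤ 1 := norm_frameDefect_le hm h1 n
  have : d * T.p1 x = d * T.p1 (x - z) + d * T.p1 z := by rw [map_sub, mul_sub]; abel
  calc ‖d * T.p1 x‖ ≤ ‖d * T.p1 (x - z)‖ + ‖d * T.p1 z‖ := this ▸ norm_add_le _ _
    _ ≤ 1 * ‖T.p1 (x - z)‖ + ‖d * T.p1 z‖ := by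
      gcongr
      exact (norm_mul_le _ _).trans (by gcongr)
    _ < ε := by
      rw [T.norm_p1 hT]
      linarith

theorem isFrame_frameMultiplier (hT : Function.Injective T.p0) {m : ℕ} (hm : 0 < m)
    {y : ℕ → X} (hy : ∑ i ∈ Finset.range m, ‖y i‖ * ‖y i‖ ≤ 1) :
    IsFrame c.toHilbertModule (c.generated m y) (c.frameMultiplier hm y) := by
  intro x hx
  have h := (tendsto_frameDefect_mul_p1 hT hm hy hx).norm
  rw [norm_zero] at h
  refine tendsto_iff_norm_sub_tendsto_zero.2 (h.congr fun n => ?_)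
  rw [norm_sub_rev, ← T.norm_p1 hT]
  congr 1
  rw [map_sub, map_sum, frameDefect, sub_mul, one_mul, Finset.sum_mul]
  congr 1
  refine Finset.sum_congr rfl fun k _ => ?_
  simp only [HilbertModule.frameMultiplier, HilbertModule.toMultiplier]
  rw [p1_smulR, ← T.star_p1_mul_p1, p1_frame, mul_assoc]

theorem IsCovariant.exists_frame_approx (hT : Function.Injective T.p0) (hcov : T.IsCovariant)
    {a : A} (ha : a ∈ c.katsura) {ε : ℝ} (hε : 0 < ε) :
    ∃ (Y : Submodule ℂ X) (xs : ℕ → Multiplier c.toHilbertModule Y) (n : ℕ) (w : ℕ → X),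
      IsClosedSubmodule c.toHilbertModule Y ∧
      IsCountablyGenerated c.toHilbertModule Y ∧
      IsFrame c.toHilbertModule Y xs ∧
      (∀ k, ∀ b : A, c.smulR (w k) b = c.lact a ((xs k).toFun b)) ∧
      ‖T.p0 (a * star a) - ∑ k ∈ Finset.range n, T.p1 (w k) * star (T.p1 (w k))‖ < ε := by
  obtain ⟨K, hK0, hK⟩ := hcov.exists_norm_sub_sum_le
  set α := T.p0 a with hα
  set δ := ε / ((K + 1) * (‖α‖ + 1)) with hδ
  have hδ0 : 0 < δ := by positivity
  obtain ⟨S, hS, haS⟩ := Metric.mem_closure_iff.1 ha.1 δ hδ0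
  obtain ⟨m, hm, z, y, rfl, hy⟩ := c.exists_eq_sum_rankOne_of_sum_sq_le hS
  have h1 := norm_sum_p1_mul_star_le hT hy
  set β := ∑ i ∈ Finset.range m, T.p1 (z i) * star (T.p1 (y i)) with hβ
  have hαβ : ‖α - β‖ ≤ K * δ := by
    refine (hK a ha m z y).trans (mul_le_mul_of_nonneg_left ?_ hK0)
    rw [← dist_eq_norm]
    exact haS.le
  have hlim : Tendsto (fun n => β * frameDefect m (fun i => T.p1 (y i)) n) atTop (𝓝 0) := by
    have h : ∀ i ∈ Finset.range m, Tendsto (fun n => T.p1 (z i) *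
        star (frameDefect m (fun i => T.p1 (y i)) n * T.p1 (y i))) atTop (𝓝 0) := by
      intro i hi
      simpa using (tendsto_frameDefect_mul (η := fun i => T.p1 (y i)) hm h1
        (Finset.mem_range.1 hi)).star.const_mul (T.p1 (z i))
    refine (by simpa using tendsto_finsetSum _ h : Tendsto _ _ _).congr fun n => ?_
    rw [hβ, Finset.sum_mul]
    refine Finset.sum_congr rfl fun i _ => ?_
    rw [(frameDefect_nonneg hm h1 n).isSelfAdjoint.star_eq, mul_assoc]
  obtain ⟨n, hn⟩ := (Metric.tendsto_atTop.1 hlim δ hδ0).imp fun N h => h N le_rfl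
  rw [dist_zero_right] at hn
  refine ⟨c.generated m y, c.frameMultiplier hm y, n,
    fun k => c.lact a (c.residualVec m y (k / m) (k % m)), c.isClosedSubmodule_generated m y,
    c.isCountablyGenerated_generated hm y, isFrame_frameMultiplier hT hm hy,
    fun k b => (c.lact_smulR a (c.residualVec m y (k / m) (k % m)) b).symm, ?_⟩
  rw [p0_sub_sum_eq]
  set d := frameDefect m (fun i => T.p1 (y i)) n
  have hd1 : ‖d‖ ≤ 1 := norm_frameDefect_le hm h1 n
  have hαd : ‖α * d‖ ≤ (K + 1) * δ := by
    calc ‖α * d‖ = ‖(α - β) * d + β * d‖ := by rw [sub_mul, sub_add_cancel]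
      _ ≤ ‖α - β‖ * ‖d‖ + ‖β * d‖ := (norm_add_le _ _).trans (by gcongr; exact norm_mul_le _ _)
      _ ≤ K * δ * 1 + δ := by gcongr
      _ = (K + 1) * δ := by ring
  calc ‖α * d * star α‖ ≤ ‖α * d‖ * ‖star α‖ := norm_mul_le _ _
    _ ≤ (K + 1) * δ * ‖α‖ := by rw [norm_star]; gcongr
    _ < (K + 1) * δ * (‖α‖ + 1) := by gcongr; linarith
    _ = ε := by rw [hδ]; field_simp

end Unital

end ToeplitzPair

/-- For `a ∈ J_X`, the element `ι⁰(aa*)` of the Cuntz-Pimsner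
algebra is the iterated limit of the finite sums
`∑_{k<n} ι¹(a·x_k(Y)) ι¹(a·x_k(Y))*` over countably generated closed
submodules `Y ⊆ X` with standard normalized frames `(x_k(Y))`: for every
`ε > 0` there are such `Y`, a frame `xs`, `n ∈ ℕ` and elements `w k ∈ X`
representing the compact operators `λ(a) ∘ x_k(Y) : A → X` (that is,
`w k · b = λ(a)(x_k(Y)(b))` for all `b ∈ A`) with
`‖ι⁰(aa*) - ∑_{k<n} ι¹(w k) ι¹(w k)*‖ < ε`. -/
theorem p0_mul_star_approx
    {A : Type u} {X : Type v} [NonUnitalCStarAlgebra A] [NormedAddCommGroup X]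
    [NormedSpace ℂ X] [CompleteSpace X] (c : Correspondence A X)
    (O : Type w) [NonUnitalCStarAlgebra O] (ι : ToeplitzPair c O)
    (hO : IsCuntzPimsner c O ι) {a : A} (ha : a ∈ c.katsura) :
    ∀ ε > (0 : ℝ), ∃ (Y : Submodule ℂ X) (xs : ℕ → Multiplier c.toHilbertModule Y)
      (n : ℕ) (w : ℕ → X),
      IsClosedSubmodule c.toHilbertModule Y ∧
      IsCountablyGenerated c.toHilbertModule Y ∧
      IsFrame c.toHilbertModule Y xs ∧
      (∀ k, ∀ b : A, c.toHilbertModule.smulR (w k) b = c.lact a ((xs k).toFun b)) ∧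
      ‖ι.p0 (a * star a) - ∑ k ∈ Finset.range n, ι.p1 (w k) * star (ι.p1 (w k))‖ < ε := by
  let : PartialOrder (Unitization ℂ O) := CStarAlgebra.spectralOrder _
  have : StarOrderedRing (Unitization ℂ O) := CStarAlgebra.spectralOrderedRing _
  intro ε hε
  let ρ : O →⋆ₙₐ[ℂ] Unitization ℂ O := Unitization.inrNonUnitalStarAlgHom ℂ O
  have hρ : Function.Injective ρ := Unitization.inr_injective
  obtain ⟨Y, xs, n, w, h1, h2, h3, h4, h5⟩ :=
    (hO.covariant.map ρ).exists_frame_approx (hρ.comp hO.injective) ha hε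
  refine ⟨Y, xs, n, w, h1, h2, h3, h4, ?_⟩
  rw [← NonUnitalStarAlgHom.norm_map ρ hρ]
  simp only [map_sub, map_sum, map_mul, map_star] at h5 ⊢
  exact h5

end
end
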